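/- The map ι satisfies Ψ(ι(x), ι(y)) = ψ_A(x, y) for all x, y ∈ V₁; moreover S ∩ ι(R₁♯) = {0} and R × R₂♯ = S + ι(R₁♯). Hence the ℤ-module R × R₂♯ is the internal direct sum of S and ι(R₁♯), and this decomposition is orthogonal with respect to Ψ. -/

import Mathlib

open Matrix

noncomputable section

/-- `ψ_M(x, y) = xᵀ M y`, the bilinear form on `ℚᵏ` associated with an integer matrix `M`. -/
def psi {k : ℕ} (M : Matrix (Fin k) (Fin k) ℤ) (x y : Fin k → ℚ) : ℚ :=
  x ⬝ᵥ ((M.map (fun a => (a : ℚ))) *ᵥ y)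

/-- A rational number is an integer. -/
def IsIntQ (q : ℚ) : Prop := ∃ a : ℤ, q = a

/-- A rational vector has integer entries, i.e. belongs to the lattice `ℤᵏ ⊂ ℚᵏ`. -/
def IsIntVec {k : ℕ} (x : Fin k → ℚ) : Prop := ∀ i, IsIntQ (x i)

/-- `x` belongs to the dual lattice of `ℤᵏ` with respect to `ψ_M`. -/
def InDual {k : ℕ} (M : Matrix (Fin k) (Fin k) ℤ) (x : Fin k → ℚ) : Prop :=
  ∀ y, IsIntVec y → IsIntQ (psi M x y)

/-- The form `ψ_R` on `V₁ × V₁`: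
`ψ_R((x,y),(x',y')) = ψ_A(x,y') + ψ_A(x',y) + ψ_A(y,y') − ψ_B(f(y),f(y'))`. -/
def psiR {n m : ℕ} (A : Matrix (Fin n) (Fin n) ℤ) (B : Matrix (Fin m) (Fin m) ℤ)
    (f : (Fin n → ℚ) →ₗ[ℚ] (Fin m → ℚ)) (u v : (Fin n → ℚ) × (Fin n → ℚ)) : ℚ :=
  psi A u.1 v.2 + psi A v.1 u.2 + psi A u.2 v.2 - psi B (f u.2) (f v.2)

/-- Membership in the lattice `R = R₁ × R₁♯ ⊂ V₁ × V₁`. -/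
def InR {n : ℕ} (A : Matrix (Fin n) (Fin n) ℤ) (u : (Fin n → ℚ) × (Fin n → ℚ)) : Prop :=
  IsIntVec u.1 ∧ InDual A u.2

/-- The ambient space `W = (V₁ × V₁) × V₂`. -/
abbrev WSp (n m : ℕ) : Type := ((Fin n → ℚ) × (Fin n → ℚ)) × (Fin m → ℚ)

/-- The orthogonal direct sum form `Ψ = ψ_R ⊕ ψ_B` on `W`. -/
def PsiW {n m : ℕ} (A : Matrix (Fin n) (Fin n) ℤ) (B : Matrix (Fin m) (Fin m) ℤ)
    (f : (Fin n → ℚ) →ₗ[ℚ] (Fin m → ℚ)) (w w' : WSp n m) : ℚ :=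
  psiR A B f w.1 w'.1 + psi B w.2 w'.2

/-- The map `ι : V₁ → W`, `ι(y) = ((0, y), f(y))`. -/
def iota {n m : ℕ} (f : (Fin n → ℚ) →ₗ[ℚ] (Fin m → ℚ)) (y : Fin n → ℚ) : WSp n m :=
  ((0, y), f y)

/-- Membership in `S = {z ∈ R × R₂♯ : Ψ(z, ι(r)) = 0 for all r ∈ R₁♯}`. -/
def InS {n m : ℕ} (A : Matrix (Fin n) (Fin n) ℤ) (B : Matrix (Fin m) (Fin m) ℤ)
    (f : (Fin n → ℚ) →ₗ[ℚ] (Fin m → ℚ)) (w : WSp n m) : Prop :=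
  (InR A w.1 ∧ InDual B w.2) ∧ ∀ r, InDual A r → PsiW A B f w (iota f r) = 0

theorem aux_add_left {k : ℕ} (M : Matrix (Fin k) (Fin k) ℤ) (x y z : Fin k → ℚ) :
    psi M (x + y) z = psi M x z + psi M y z := by
  simp [psi, add_dotProduct]

theorem aux_sub_left {k : ℕ} (M : Matrix (Fin k) (Fin k) ℤ) (x y z : Fin k → ℚ) :
    psi M (x - y) z = psi M x z - psi M y z := by
  simp [psi, sub_dotProduct]

theorem aux_zero_left {k : ℕ} (M : Matrix (Fin k) (Fin k) ℤ) (z : Fin k → ℚ) :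
    psi M 0 z = 0 := by
  simp [psi]

theorem aux_add {a b : ℚ} (ha : IsIntQ a) (hb : IsIntQ b) : IsIntQ (a + b) := by
  obtain ⟨u, rfl⟩ := ha
  obtain ⟨v, rfl⟩ := hb
  exact ⟨u + v, by push_cast; rfl⟩

theorem aux_sub {a b : ℚ} (ha : IsIntQ a) (hb : IsIntQ b) : IsIntQ (a - b) := by
  obtain ⟨u, rfl⟩ := ha
  obtain ⟨v, rfl⟩ := hb
  exact ⟨u - v, by push_cast; rfl⟩

theorem aux_int_dual {k : ℕ} (M : Matrix (Fin k) (Fin k) ℤ) (x : Fin k → ℚ)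
    (hx : IsIntVec x) : InDual M x := by
  intro y hy
  choose a ha using hx
  choose b hb using hy
  refine ⟨∑ i, a i * ∑ j, M i j * b j, ?_⟩
  simp [psi, dotProduct, mulVec, ha, hb]

theorem aux_dual_sub {k : ℕ} (M : Matrix (Fin k) (Fin k) ℤ) (x y : Fin k → ℚ)
    (hx : InDual M x) (hy : InDual M y) : InDual M (x - y) := by
  intro z hz
  rw [aux_sub_left]
  exact aux_sub (hx z hz) (hy z hz)

theorem aux_det {k : ℕ} (M : Matrix (Fin k) (Fin k) ℤ) (h : M.det ≠ 0) :
    IsUnit (M.map (fun a => (a : ℚ))).det := by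
  have h2 : (M.map (fun a => (a : ℚ))).det = (M.det : ℚ) := by
    have := (Int.castRingHom ℚ).map_det M
    simpa [RingHom.mapMatrix_apply] using this.symm
  rw [h2, isUnit_iff_ne_zero]
  exact_mod_cast h

theorem aux_nondeg {k : ℕ} (M : Matrix (Fin k) (Fin k) ℤ) (h : M.det ≠ 0) (x : Fin k → ℚ)
    (hx : ∀ r, InDual M r → psi M x r = 0) : x = 0 := by
  have h0 : x ᵥ* (M.map (fun a => (a : ℚ))) = 0 := by
    funext i
    have hi := hx (Pi.single i 1) (aux_int_dual M _ (fun j => by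
      by_cases hj : j = i
      · subst hj; exact ⟨1, by simp⟩
      · exact ⟨0, by simp [hj]⟩))
    rw [psi, dotProduct_mulVec, dotProduct_single_one] at hi
    exact hi
  have h1 : x ᵥ* (M.map (fun a => (a : ℚ))) ᵥ* (M.map (fun a => (a : ℚ)))⁻¹ = 0 := by
    rw [h0, zero_vecMul]
  rwa [vecMul_vecMul, mul_nonsing_inv _ (aux_det M h), vecMul_one] at h1

theorem aux_repr {n m : ℕ} (A : Matrix (Fin n) (Fin n) ℤ) (h : A.det ≠ 0)
    (B : Matrix (Fin m) (Fin m) ℤ) (f : (Fin n → ℚ) →ₗ[ℚ] (Fin m → ℚ)) (u : Fin m → ℚ) :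
    ∃ t, ∀ r, psi A t r = psi B u (f r) := by
  refine ⟨u ᵥ* (B.map (fun a => (a : ℚ))) ᵥ* (LinearMap.toMatrix' f) ᵥ*
    (A.map (fun a => (a : ℚ)))⁻¹, fun r => ?_⟩
  rw [psi, psi, dotProduct_mulVec, vecMul_vecMul, nonsing_inv_mul _ (aux_det A h), vecMul_one,
    ← dotProduct_mulVec, ← dotProduct_mulVec, LinearMap.toMatrix'_mulVec]

/-- `Ψ(ι x, ι y) = ψ_A(x, y)`, `S ∩ ι(R₁♯) = {0}`, and
`R × R₂♯ = S + ι(R₁♯)`; hence `R × R₂♯` is the internal direct sum of `S` and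
`ι(R₁♯)`, orthogonally with respect to `Ψ`. -/
theorem S_iota_direct_sum {n m : ℕ}
    (A : Matrix (Fin n) (Fin n) ℤ) (hAsym : A.IsSymm) (hAdet : A.det ≠ 0)
    (B : Matrix (Fin m) (Fin m) ℤ) (hBsym : B.IsSymm) (hBdet : B.det ≠ 0)
    (f : (Fin n → ℚ) →ₗ[ℚ] (Fin m → ℚ))
    (hfdual : ∀ x, InDual A x → InDual B (f x))
    (hfint : ∀ x, IsIntVec x → IsIntVec (f x))
    (hfinj : ∀ x, InDual A x → IsIntVec (f x) → IsIntVec x)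
    (hfsurj : ∀ z, InDual B z → ∃ x, InDual A x ∧ IsIntVec (z - f x))
    (hfiso : ∀ x y, InDual A x → InDual A y → IsIntQ (psi B (f x) (f y) - psi A x y)) :
    (∀ x y : Fin n → ℚ, PsiW A B f (iota f x) (iota f y) = psi A x y) ∧
    (∀ w : WSp n m, InS A B f w → (∃ r, InDual A r ∧ w = iota f r) → w = 0) ∧
    (∀ w : WSp n m, InR A w.1 ∧ InDual B w.2 →
      ∃ s r, InS A B f s ∧ InDual A r ∧ w = s + iota f r) ∧
    (∀ (w s s' : WSp n m) (r r' : Fin n → ℚ), InS A B f s → InS A B f s' →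
      InDual A r → InDual A r' → w = s + iota f r → w = s' + iota f r' →
      s = s' ∧ r = r') ∧
    (∀ (s : WSp n m) (r : Fin n → ℚ), InS A B f s → InDual A r →
      PsiW A B f s (iota f r) = 0) := by
  have key : ∀ (w : WSp n m) r, PsiW A B f w (iota f r) =
      psi A w.1.1 r + psi A w.1.2 r - psi B (f w.1.2) (f r) + psi B w.2 (f r) := by
    intro w r
    simp [PsiW, psiR, iota, aux_zero_left]
  have h1 : ∀ x y : Fin n → ℚ, PsiW A B f (iota f x) (iota f y) = psi A x y := by
    intro x y
    rw [key]
    simp [iota, aux_zero_left]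
  have hadd : ∀ (w : WSp n m) r r', PsiW A B f (w + iota f r) (iota f r') =
      PsiW A B f w (iota f r') + psi A r r' := by
    intro w r r'
    rw [key, key]
    simp [iota, aux_add_left]
    ring
  refine ⟨h1, ?_, ?_, ?_, fun s r hs hr => hs.2 r hr⟩
  · rintro w hw ⟨r, hr, rfl⟩
    have : r = 0 := aux_nondeg A hAdet r (fun r' hr' => by rw [← h1]; exact hw.2 r' hr')
    subst this
    simp [iota]
  · rintro ⟨⟨x, y⟩, z⟩ ⟨⟨hx, hy⟩, hz⟩
    simp only at hx hy hz
    obtain ⟨t, ht⟩ := aux_repr A hAdet B f (z - f y)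
    have hphi : ∀ r, psi A (x + y + t) r = PsiW A B f ((x, y), z) (iota f r) := by
      intro r
      rw [key, aux_add_left, aux_add_left, ht, aux_sub_left]
      ring
    have hd : InDual A (x + y + t) := by
      intro r hr
      rw [aux_add_left, aux_add_left, ht]
      exact aux_add (aux_add (aux_int_dual A x hx r hr) (hy r hr))
        (aux_dual_sub B _ _ hz (hfdual y hy) _ (hfint r hr))
    have hw : (((x, y), z) : WSp n m) =
        ((x, y - (x + y + t)), z - f (x + y + t)) + iota f (x + y + t) := by
      simp only [iota, Prod.mk_add_mk, add_zero, sub_add_cancel]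
    refine ⟨((x, y - (x + y + t)), z - f (x + y + t)), x + y + t,
      ⟨⟨⟨hx, aux_dual_sub A _ _ hy hd⟩, aux_dual_sub B _ _ hz (hfdual _ hd)⟩, ?_⟩, hd, hw⟩
    intro r hr
    have e := hphi r
    rw [hw, hadd] at e
    linarith
  · intro w s s' r r' hs hs' hr hr' hw hw'
    have hrr : r = r' := by
      rw [← sub_eq_zero]
      refine aux_nondeg A hAdet _ (fun q hq => ?_)
      have e := hadd s r q
      have e' := hadd s' r' q
      rw [← hw, hs.2 q hq] at e
      rw [← hw', hs'.2 q hq] at e'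
      rw [aux_sub_left]
      linarith
    subst hrr
    exact ⟨add_right_cancel (hw.symm.trans hw'), rfl⟩
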